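/- arXiv:2511.11926 — 2 statements merged into one kernel-verified Lean document; each statement's English description precedes it below -/
import Mathlib

section
/- Let G be a finite group and let a, b ∈ G with a ∉ Z(G) and b ∉ Z(G). Then a ∈ Z(b) if and only if Z(a) ≤ Z(b). -/
/-- `Z(g) = Z(C_G(g))` regarded as a subgroup of `G`; since `g ∈ C_G(g)`, this equals
the centralizer of `C_G(g)` in `G`. -/
def zCent (G : Type*) [Group G] (g : G) : Subgroup G :=
  Subgroup.centralizer ((Subgroup.centralizer ({g} : Set G) : Subgroup G) : Set G)

theorem mem_zCent_self {G : Type*} [Group G] (g : G) : g ∈ zCent G g :=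
  Subgroup.mem_centralizer_iff.2 fun _ hx => (Subgroup.mem_centralizer_iff.1 hx g rfl).symm

theorem centralizer_singleton_le_of_mem_zCent {G : Type*} [Group G] {a b : G}
    (h : a ∈ zCent G b) :
    Subgroup.centralizer ({b} : Set G) ≤ Subgroup.centralizer ({a} : Set G) := by
  intro x hx
  rw [Subgroup.mem_centralizer_iff]
  rintro _ rfl
  exact (Subgroup.mem_centralizer_iff.1 h x hx).symm

theorem stmt_1 (G : Type*) [Group G] [Fintype G] (a b : G)
    (ha : a ∉ Subgroup.center G) (hb : b ∉ Subgroup.center G) :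
    a ∈ zCent G b ↔ zCent G a ≤ zCent G b :=
  ⟨fun h => Subgroup.centralizer_le (centralizer_singleton_le_of_mem_zCent h),
    fun h => h (mem_zCent_self a)⟩
end

section
/- Let G be a finite group and let g ∈ G with g ∉ Z(G). Then the following are equivalent: (1) for every h ∈ G with h ∉ Z(G), either C_G(h) = C_G(g) or C_G(h) ⊓ C_G(g) = Z(G); (2) C_G(h) = C_G(g) for every h ∈ C_G(g) \ Z(G); (3) Z(h) = C_G(g) for every h ∈ C_G(g) \ Z(G). -/
theorem mem_centralizer_singleton_comm {G : Type*} [Group G] {a b : G} :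
    a ∈ Subgroup.centralizer ({b} : Set G) ↔ b ∈ Subgroup.centralizer ({a} : Set G) := by
  simp only [Subgroup.mem_centralizer_singleton_iff, eq_comm]

theorem mem_centralizer_singleton_self {G : Type*} [Group G] (a : G) :
    a ∈ Subgroup.centralizer ({a} : Set G) :=
  Subgroup.mem_centralizer_singleton_iff.2 rfl

theorem mem_zCent_iff {G : Type*} [Group G] {g x : G} :
    x ∈ zCent G g ↔ ∀ y ∈ Subgroup.centralizer ({g} : Set G),
      x ∈ Subgroup.centralizer ({y} : Set G) := by
  simp only [zCent, Subgroup.mem_centralizer_iff, Set.mem_singleton_iff, forall_eq,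
    SetLike.mem_coe]

theorem stmt_12 (G : Type*) [Group G] [Fintype G] (g : G)
    (hg : g ∉ Subgroup.center G) :
    ((∀ h : G, h ∉ Subgroup.center G →
        Subgroup.centralizer ({h} : Set G) = Subgroup.centralizer ({g} : Set G) ∨
        Subgroup.centralizer ({h} : Set G) ⊓ Subgroup.centralizer ({g} : Set G) =
          Subgroup.center G) ↔
      (∀ h : G, h ∈ Subgroup.centralizer ({g} : Set G) → h ∉ Subgroup.center G →
        Subgroup.centralizer ({h} : Set G) = Subgroup.centralizer ({g} : Set G))) ∧
    ((∀ h : G, h ∈ Subgroup.centralizer ({g} : Set G) → h ∉ Subgroup.center G →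
        Subgroup.centralizer ({h} : Set G) = Subgroup.centralizer ({g} : Set G)) ↔
      (∀ h : G, h ∈ Subgroup.centralizer ({g} : Set G) → h ∉ Subgroup.center G →
        zCent G h = Subgroup.centralizer ({g} : Set G))) := by
  refine ⟨⟨fun H h hh hz => ?_, fun H h hz => ?_⟩, ⟨fun H h hh hz => ?_, fun H h hh hz => ?_⟩⟩
  · refine (H h hz).resolve_right fun e => hz ?_
    rw [← e]
    exact ⟨mem_centralizer_singleton_self h, hh⟩
  · refine or_iff_not_imp_right.2 fun hne => ?_
    obtain ⟨x, ⟨hxh, hxg⟩, hxz⟩ : ∃ x ∈ Subgroup.centralizer ({h} : Set G) ⊓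
        Subgroup.centralizer ({g} : Set G), x ∉ Subgroup.center G := by
      by_contra! hc
      exact hne (le_antisymm hc
        (le_inf (Subgroup.center_le_centralizer _) (Subgroup.center_le_centralizer _)))
    refine H h ?_ hz
    rw [← H x hxg hxz]
    exact mem_centralizer_singleton_comm.1 hxh
  · ext x
    rw [mem_zCent_iff, H h hh hz]
    refine ⟨fun hx => hx g (mem_centralizer_singleton_self g), fun hx y hy => ?_⟩
    by_cases hyz : y ∈ Subgroup.center G
    · exact mem_centralizer_singleton_comm.1 (Subgroup.center_le_centralizer _ hyz)
    · rwa [H y hy hyz]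
  · refine le_antisymm (fun x hx => ?_) fun x hx => ?_
    · have hgh : g ∈ zCent G h := by
        rw [H h hh hz]
        exact mem_centralizer_singleton_self g
      exact mem_centralizer_singleton_comm.1 (mem_zCent_iff.1 hgh x hx)
    · rw [← H h hh hz] at hx
      exact mem_zCent_iff.1 hx h (mem_centralizer_singleton_self h)
end
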